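/- arXiv:2205.05133 — 8 statements merged into one kernel-verified Lean document; each statement's English description precedes it below -/
import Mathlib

section
/- Let X be a Polish space, let (μ_n)_{n≥1} be Borel probability measures on X converging weakly to a Borel probability measure μ, and let ξ_n, ξ : X → [0,∞) be continuous functions with sup_{n≥1} ‖ξ_n‖_∞ < ∞, ξ bounded, and ξ_n → ξ uniformly on every compact subset of X. Assume ∫ ξ_n dμ_n = 1 for every n and ∫ ξ dμ = 1, so that the measures μ_n^ν := ξ_n · μ_n (the measure with density ξ_n with respect to μ_n) and μ^ν := ξ · μ are probability measures. Then μ_n^ν converges weakly to μ^ν as n → ∞. -/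
open MeasureTheory Filter Topology

/-- A weakly convergent sequence of probability measures on a Polish space is tight. -/
theorem isTightMeasureSet_range_of_tendsto {X : Type*} [TopologicalSpace X] [PolishSpace X]
    [MeasurableSpace X] [BorelSpace X] {μ : ℕ → ProbabilityMeasure X} {μ₀ : ProbabilityMeasure X}
    (h : Tendsto μ atTop (𝓝 μ₀)) :
    IsTightMeasureSet (Set.range fun n => (μ n : Measure X)) := by
  let := TopologicalSpace.upgradeIsCompletelyMetrizable X
  have hc : IsCompact (closure (insert μ₀ (Set.range μ))) := by
    have := h.isCompact_insert_range
    rwa [this.isClosed.closure_eq]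
  refine (isTightMeasureSet_of_isCompact_closure hc).subset ?_
  rintro _ ⟨n, rfl⟩
  exact ⟨μ n, Set.mem_insert_of_mem _ ⟨n, rfl⟩, rfl⟩

/-- Along a tight sequence of probability measures, uniformly bounded functions converging
uniformly on compact sets converge in mean. -/
theorem tendsto_integral_abs_sub_of_isTightMeasureSet {X : Type*} [TopologicalSpace X] [T2Space X]
    [MeasurableSpace X] [OpensMeasurableSpace X] {μ : ℕ → Measure X}
    [∀ n, IsProbabilityMeasure (μ n)] (hμ : IsTightMeasureSet (Set.range μ))
    {f : ℕ → X → ℝ} {f₀ : X → ℝ} {C : ℝ} (hC : ∀ n x, |f n x - f₀ x| ≤ C)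
    (hf : ∀ K : Set X, IsCompact K → TendstoUniformlyOn f f₀ atTop K) :
    Tendsto (fun n => ∫ x, |f n x - f₀ x| ∂(μ n)) atTop (𝓝 0) := by
  obtain ⟨x₀⟩ : Nonempty X := (μ 0).nonempty_of_neZero
  have hC0 : 0 ≤ C := (abs_nonneg _).trans (hC 0 x₀)
  rw [Metric.tendsto_atTop']
  intro ε hε
  set δ := ε / (C + 2) with hδ
  have hδ0 : 0 < δ := by positivity
  obtain ⟨K, hK, hμK⟩ := isTightMeasureSet_iff_exists_isCompact_measure_compl_le.1 hμ
    (ENNReal.ofReal δ) (by simpa using hδ0)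
  obtain ⟨N, hN⟩ := eventually_atTop.1 (Metric.tendstoUniformlyOn_iff.1 (hf K hK) δ hδ0)
  refine ⟨N, fun n hn => ?_⟩
  have hKm : MeasurableSet Kᶜ := hK.isClosed.measurableSet.compl
  have hKn : (μ n).real Kᶜ ≤ δ := ENNReal.toReal_le_of_le_ofReal hδ0.le (hμK _ ⟨n, rfl⟩)
  have hpt (x : X) : |f n x - f₀ x| ≤ δ + Kᶜ.indicator (fun _ => C) x := by
    by_cases hx : x ∈ K
    · have := hN n hn.le x hx
      rw [dist_comm, Real.dist_eq] at this
      simpa [hx] using this.le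
    · have := hC n x
      simp only [Set.mem_compl_iff, hx, not_false_eq_true, Set.indicator_of_mem]
      linarith
  have hint : Integrable (Kᶜ.indicator fun _ => C) (μ n) := (integrable_const C).indicator hKm
  have hle : ∫ x, |f n x - f₀ x| ∂(μ n) ≤ δ + δ * C := by
    calc ∫ x, |f n x - f₀ x| ∂(μ n) ≤ ∫ x, (δ + Kᶜ.indicator (fun _ => C) x) ∂(μ n) :=
          integral_mono_of_nonneg (.of_forall fun _ => abs_nonneg _)
            ((integrable_const δ).add hint) (.of_forall hpt)
      _ = δ + (μ n).real Kᶜ * C := by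
          rw [integral_add (integrable_const δ) hint, integral_indicator_const C hKm]
          simp
      _ ≤ δ + δ * C := by gcongr
  have hnn : 0 ≤ ∫ x, |f n x - f₀ x| ∂(μ n) := integral_nonneg fun _ => abs_nonneg _
  rw [Real.dist_eq, sub_zero, abs_of_nonneg hnn]
  have : δ * (C + 2) = ε := by rw [hδ]; field_simp
  linarith

/-- The integral against a measure with real density. -/
theorem integral_withDensity_ofReal {X : Type*} [MeasurableSpace X] {μ : Measure X} {f : X → ℝ}
    (hf : Measurable f) (hf0 : ∀ x, 0 ≤ f x) (g : X → ℝ) :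
    ∫ x, g x ∂(μ.withDensity fun x => ENNReal.ofReal (f x)) = ∫ x, f x * g x ∂μ := by
  rw [integral_withDensity_eq_integral_toReal_smul hf.ennreal_ofReal (by simp)]
  simp [ENNReal.toReal_ofReal (hf0 _)]

/-- If `μ n → μ₀` weakly on a Polish space and the continuous densities `ξ n` are uniformly
bounded, converge to `ξ₀` uniformly on compact sets, and integrate to `1`, then the
probability measures `ξ n · μ n` converge weakly to `ξ₀ · μ₀`. -/
theorem stmt_2 {X : Type*} [TopologicalSpace X] [PolishSpace X]
    [MeasurableSpace X] [BorelSpace X]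
    (μ : ℕ → Measure X) (μ₀ : Measure X)
    [∀ n, IsProbabilityMeasure (μ n)] [IsProbabilityMeasure μ₀]
    (hweak : ∀ g : BoundedContinuousFunction X ℝ,
      Tendsto (fun n => ∫ x, g x ∂(μ n)) atTop (𝓝 (∫ x, g x ∂μ₀)))
    (ξ : ℕ → X → ℝ) (ξ₀ : X → ℝ)
    (hξ_nonneg : ∀ n x, 0 ≤ ξ n x) (hξ₀_nonneg : ∀ x, 0 ≤ ξ₀ x)
    (hξ_cont : ∀ n, Continuous (ξ n)) (hξ₀_cont : Continuous ξ₀)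
    (B : ℝ) (hξ_bdd : ∀ n x, ξ n x ≤ B) (hξ₀_bdd : ∀ x, ξ₀ x ≤ B)
    (hunif : ∀ K : Set X, IsCompact K → TendstoUniformlyOn (fun n x => ξ n x) ξ₀ atTop K)
    (hξ_prob : ∀ n, ∫ x, ξ n x ∂(μ n) = 1) (hξ₀_prob : ∫ x, ξ₀ x ∂μ₀ = 1) :
    ∀ g : BoundedContinuousFunction X ℝ,
      Tendsto (fun n => ∫ x, g x ∂((μ n).withDensity (fun x => ENNReal.ofReal (ξ n x))))
        atTop (𝓝 (∫ x, g x ∂(μ₀.withDensity (fun x => ENNReal.ofReal (ξ₀ x))))) := by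
  intro g
  have hμ : IsTightMeasureSet (Set.range μ) :=
    isTightMeasureSet_range_of_tendsto
      (μ := fun n => ⟨μ n, inferInstance⟩) (μ₀ := ⟨μ₀, inferInstance⟩)
      (ProbabilityMeasure.tendsto_iff_forall_integral_tendsto.2 hweak)
  have habs (n : ℕ) (x : X) : |ξ n x - ξ₀ x| ≤ B := abs_le.2
    ⟨by linarith [hξ_nonneg n x, hξ₀_bdd x], by linarith [hξ₀_nonneg x, hξ_bdd n x]⟩
  have hmean := tendsto_integral_abs_sub_of_isTightMeasureSet hμ habs hunif
  simp_rw [fun n => integral_withDensity_ofReal (μ := μ n) (hξ_cont n).measurable (hξ_nonneg n) g,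
    integral_withDensity_ofReal (μ := μ₀) hξ₀_cont.measurable hξ₀_nonneg g]
  let ξb (n : ℕ) : BoundedContinuousFunction X ℝ := .ofNormedAddCommGroup (ξ n) (hξ_cont n) B
    fun x => by rw [Real.norm_of_nonneg (hξ_nonneg n x)]; exact hξ_bdd n x
  let ξb₀ : BoundedContinuousFunction X ℝ := .ofNormedAddCommGroup ξ₀ hξ₀_cont B
    fun x => by rw [Real.norm_of_nonneg (hξ₀_nonneg x)]; exact hξ₀_bdd x
  have hlim : Tendsto (fun n => ∫ x, ξ₀ x * g x ∂(μ n)) atTop (𝓝 (∫ x, ξ₀ x * g x ∂μ₀)) :=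
    hweak (ξb₀ * g)
  have hdiff : Tendsto (fun n => ∫ x, ξ n x * g x ∂(μ n) - ∫ x, ξ₀ x * g x ∂(μ n))
      atTop (𝓝 0) := by
    refine squeeze_zero_norm (fun n => ?_) (by simpa using hmean.mul_const ‖g‖)
    have h1 : Integrable (fun x => ξ n x * g x) (μ n) := (ξb n * g).integrable (μ n)
    have h2 : Integrable (fun x => ξ₀ x * g x) (μ n) := (ξb₀ * g).integrable (μ n)
    have h3 : Integrable (fun x => |ξ n x - ξ₀ x|) (μ n) := ((ξb n - ξb₀).integrable (μ n)).abs
    rw [← integral_sub h1 h2, ← integral_mul_const]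
    refine norm_integral_le_of_norm_le (h3.mul_const _) (.of_forall fun x => ?_)
    rw [← sub_mul, norm_mul, Real.norm_eq_abs (ξ n x - ξ₀ x)]
    gcongr
    exact g.norm_coe_le_norm x
  simpa using hdiff.add hlim
end

section
/- Let Ω be a nonempty finite set, let P̃ : Ω → ℝ be a probability weight function with P̃(ω) > 0 for all ω, let 𝒫 be a finite set and Y : Ω → 𝒫 a function, and let ν : 𝒫 → ℝ be a probability weight function with ν(y) = 0 whenever P̃(Y = y) := Σ_{ω : Y(ω)=y} P̃(ω) = 0. Define the minimal probability measure associated with the weak information (Y, ν) by P^ν(ω) := P̃(ω) · ν(Y(ω)) / P̃(Y = Y(ω)). Then for every convex function φ : ℝ → ℝ and every probability weight function Q : Ω → ℝ with Q(ω) > 0 for all ω and Q(Y = y) = ν(y) for all y ∈ 𝒫, one has Σ_{ω∈Ω} φ(Q(ω)/P̃(ω)) · P̃(ω) ≥ Σ_{ω∈Ω} φ(P^ν(ω)/P̃(ω)) · P̃(ω). In other words, P^ν minimizes E_{P̃}[φ(dQ/dP̃)] over all probability measures Q equivalent to P̃ whose law of Y equals ν. -/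
open Finset

/-- The finite-sum form of Jensen's inequality for the perspective of a convex function. -/
theorem ConvexOn.sum_mul_map_div_sum_le {ι : Type*} {φ : ℝ → ℝ}
    (hφ : ConvexOn ℝ Set.univ φ) (s : Finset ι) (w q : ι → ℝ) (hw : ∀ i ∈ s, 0 < w i) :
    (∑ i ∈ s, w i) * φ ((∑ i ∈ s, q i) / ∑ i ∈ s, w i) ≤ ∑ i ∈ s, φ (q i / w i) * w i := by
  rcases s.eq_empty_or_nonempty with rfl | hs
  · simp
  have hW : 0 < ∑ i ∈ s, w i := Finset.sum_pos hw hs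
  have hJ := hφ.map_centerMass_le (t := s) (w := w) (p := fun i => q i / w i)
    (fun i hi => (hw i hi).le) hW (fun _ _ => Set.mem_univ _)
  have hq : ∑ i ∈ s, w i * (q i / w i) = ∑ i ∈ s, q i :=
    Finset.sum_congr rfl fun i hi => mul_div_cancel₀ _ (hw i hi).ne'
  simp only [Finset.centerMass, smul_eq_mul, Function.comp_apply, hq] at hJ
  rw [inv_mul_eq_div, inv_mul_eq_div, le_div_iff₀ hW] at hJ
  simpa only [mul_comm] using hJ

/-- In a finite market, the minimal probability measure `P^ν` associated with the weak
information `(Y, ν)` minimizes `E_{P̃}[φ(dQ/dP̃)]` over all probability weights `Q`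
equivalent to `P̃` whose law of `Y` is `ν`. -/
theorem stmt_3 {Ω E : Type*} [Fintype Ω] [Nonempty Ω] [Fintype E] [DecidableEq E]
    (Pt : Ω → ℝ) (hPt_pos : ∀ ω, 0 < Pt ω) (hPt_sum : ∑ ω, Pt ω = 1)
    (Y : Ω → E)
    (ν : E → ℝ) (hν_nonneg : ∀ y, 0 ≤ ν y) (hν_sum : ∑ y, ν y = 1)
    (hν_abs : ∀ y, (∑ ω ∈ univ.filter (fun ω => Y ω = y), Pt ω) = 0 → ν y = 0)
    -- the minimal probability measure associated with the weak information `(Y, ν)`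
    (Pν : Ω → ℝ)
    (hPν : ∀ ω, Pν ω = Pt ω * ν (Y ω) / (∑ ω' ∈ univ.filter (fun ω' => Y ω' = Y ω), Pt ω'))
    (φ : ℝ → ℝ) (hφ : ConvexOn ℝ Set.univ φ)
    (Q : Ω → ℝ) (hQ_pos : ∀ ω, 0 < Q ω) (hQ_sum : ∑ ω, Q ω = 1)
    (hQ_law : ∀ y, (∑ ω ∈ univ.filter (fun ω => Y ω = y), Q ω) = ν y) :
    ∑ ω, φ (Q ω / Pt ω) * Pt ω ≥ ∑ ω, φ (Pν ω / Pt ω) * Pt ω := by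
  rw [ge_iff_le, ← Finset.sum_fiberwise univ Y, ← Finset.sum_fiberwise univ Y]
  refine Finset.sum_le_sum fun y _ => ?_
  refine le_trans (le_of_eq ?_)
    (hφ.sum_mul_map_div_sum_le _ Pt Q fun ω _ => hPt_pos ω)
  rw [hQ_law y, Finset.sum_mul]
  refine Finset.sum_congr rfl fun ω hω => ?_
  obtain rfl : Y ω = y := (Finset.mem_filter.mp hω).2
  rw [hPν ω, mul_div_assoc, mul_div_cancel_left₀ _ (hPt_pos ω).ne', mul_comm]
end

section
/- Let (Ω, 𝓕, P) be a probability space, E a measurable space, and Y : Ω → E a measurable map. Let Q be a probability measure on (Ω, 𝓕) with Q ≪ P and density ρ := dQ/dP, and let ν := Y_*Q be the law of Y under Q. Then Y_*Q ≪ Y_*P; let ξ := d(Y_*Q)/d(Y_*P) be the Radon–Nikodym derivative. Let φ : ℝ → ℝ be a convex continuous function such that ω ↦ φ(ρ(ω)) and ω ↦ φ(ξ(Y(ω))) are both P-integrable. Then ∫_Ω φ(ξ(Y(ω))) dP(ω) ≤ ∫_Ω φ(ρ(ω)) dP(ω). In particular, the minimal probability measure associated with the weak information (Y, ν), namely P^ν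 := (ξ ∘ Y) · P, minimizes E_P[φ(dQ/dP)] over probability measures Q ≪ P whose Y-law is ν. -/
open MeasureTheory

/-- Minimality of the probability measure associated with weak information: if `Q ≪ P` with
density `ρ = dQ/dP`, then `Y_*Q ≪ Y_*P`, and with `ξ = d(Y_*Q)/d(Y_*P)` one has
`∫ φ(ξ(Y ω)) dP ≤ ∫ φ(ρ ω) dP` for every convex continuous `φ` making both sides integrable. -/
theorem stmt_4 {Ω E : Type*} [MeasurableSpace Ω] [MeasurableSpace E]
    (P Q : Measure Ω) [IsProbabilityMeasure P] [IsProbabilityMeasure Q]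
    (Y : Ω → E) (hY : Measurable Y)
    (hQP : Q ≪ P)
    (ρ : Ω → ℝ) (hρ : ρ = fun ω => (Q.rnDeriv P ω).toReal)
    (ξ : E → ℝ) (hξ : ξ = fun e => ((Q.map Y).rnDeriv (P.map Y) e).toReal)
    (φ : ℝ → ℝ) (hφ_conv : ConvexOn ℝ Set.univ φ) (hφ_cont : Continuous φ)
    (hint_ρ : Integrable (fun ω => φ (ρ ω)) P)
    (hint_ξ : Integrable (fun ω => φ (ξ (Y ω))) P) :
    Q.map Y ≪ P.map Y ∧ ∫ ω, φ (ξ (Y ω)) ∂P ≤ ∫ ω, φ (ρ ω) ∂P := by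
  subst hρ hξ
  refine ⟨hQP.map hY, ?_⟩
  have hjensen := hφ_conv.map_condExp_le_univ hY.comap_le hφ_cont.lowerSemicontinuous
    (Measure.integrable_toReal_rnDeriv (μ := Q) (ν := P)) hint_ρ
  rw [← integral_condExp hY.comap_le (f := fun ω => φ (Q.rnDeriv P ω).toReal)]
  refine integral_mono_ae hint_ξ integrable_condExp ?_
  filter_upwards [toReal_rnDeriv_map hQP hY, hjensen] with ω hξ_eq hle
  rw [hξ_eq]
  exact hle
end

section
/- In the trinomial weak-information setup with horizon n: for every 0 ≤ m ≤ n and all naturals i, j with i + j ≤ m, P^ν(U_m = i ∧ M_m = j) = Σ_{(h,k) : h+k ≤ n, i ≤ h, j ≤ k, (h-i)+(k-j) ≤ n-m} ν(h,k) · C(m; i, j) · C(n-m; h-i, k-j) / C(n; h, k), where all summands whose arguments fall outside these ranges are 0. -/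
open Finset

/-- The trinomial coefficient `m! / (i! j! (m-i-j)!)` (for `i + j ≤ m`). -/
def triCoeff (m i j : ℕ) : ℕ :=
  m.factorial / (i.factorial * j.factorial * (m - i - j).factorial)

/-- Number of up-moves (value `0`) among the first `m` steps of `ω`. -/
def upCount (n m : ℕ) (ω : Fin n → Fin 3) : ℕ :=
  (univ.filter (fun j : Fin n => (j : ℕ) < m ∧ ω j = 0)).card

/-- Number of middle-moves (value `1`) among the first `m` steps of `ω`. -/
def midCount (n m : ℕ) (ω : Fin n → Fin 3) : ℕ :=
  (univ.filter (fun j : Fin n => (j : ℕ) < m ∧ ω j = 1)).card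

/-- The product probability weight of a trinomial path `ω`, each step having weights
`(p₁, p₂, p₃)`. -/
noncomputable def triWeight (n : ℕ) (p₁ p₂ p₃ : ℝ) (ω : Fin n → Fin 3) : ℝ :=
  ∏ j, ![p₁, p₂, p₃] (ω j)

/-- The minimal probability measure associated with the weak information `ν` in the
trinomial model with horizon `n`:
`P^ν(A) = Σ_{h+k≤n} ν(h,k) · P̃(A ∩ {U_n = h, M_n = k}) / P̃(U_n = h, M_n = k)`. -/
noncomputable def triPnu (n : ℕ) (p₁ p₂ p₃ : ℝ) (ν : ℕ → ℕ → ℝ) (A : Finset (Fin n → Fin 3)) : ℝ :=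
  ∑ h ∈ range (n + 1), ∑ k ∈ range (n + 1 - h),
    ν h k *
      (∑ ω ∈ A.filter (fun ω => upCount n n ω = h ∧ midCount n n ω = k),
        triWeight n p₁ p₂ p₃ ω) /
      (∑ ω ∈ univ.filter (fun ω => upCount n n ω = h ∧ midCount n n ω = k),
        triWeight n p₁ p₂ p₃ ω)

theorem upCount_self_eq_sum (n : ℕ) (ω : Fin n → Fin 3) :
    upCount n n ω = ∑ j, if ω j = 0 then 1 else 0 := by
  simp [upCount]

theorem midCount_self_eq_sum (n : ℕ) (ω : Fin n → Fin 3) :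
    midCount n n ω = ∑ j, if ω j = 1 then 1 else 0 := by
  simp [midCount]

/-- Number of down-moves (value `2`) of `ω`. -/
def downCount (n : ℕ) (ω : Fin n → Fin 3) : ℕ :=
  ∑ j, if ω j = 2 then 1 else 0

theorem upCount_add_midCount_add_downCount (n : ℕ) (ω : Fin n → Fin 3) :
    upCount n n ω + midCount n n ω + downCount n ω = n := by
  rw [upCount_self_eq_sum, midCount_self_eq_sum, downCount, ← sum_add_distrib,
    ← sum_add_distrib]
  have key : ∀ x : Fin 3, (((if x = 0 then 1 else 0) + if x = 1 then 1 else 0) +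
      if x = 2 then 1 else 0) = 1 := by decide
  simp [key]

theorem triWeight_eq_pow (n : ℕ) (p₁ p₂ p₃ : ℝ) (ω : Fin n → Fin 3) :
    triWeight n p₁ p₂ p₃ ω =
      p₁ ^ upCount n n ω * p₂ ^ midCount n n ω * p₃ ^ downCount n ω := by
  rw [upCount_self_eq_sum, midCount_self_eq_sum, downCount, ← prod_pow_eq_pow_sum,
    ← prod_pow_eq_pow_sum, ← prod_pow_eq_pow_sum, ← prod_mul_distrib, ← prod_mul_distrib,
    triWeight]
  refine prod_congr rfl fun j _ => ?_
  generalize ω j = x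
  fin_cases x <;> simp

/-- The number of paths with prescribed counts of each of the three moves. -/
def pathCount (n h k l : ℕ) : ℕ :=
  ∑ ω : Fin n → Fin 3,
    if upCount n n ω = h ∧ midCount n n ω = k ∧ downCount n ω = l then 1 else 0

theorem pathCount_succ (n h k l : ℕ) :
    pathCount (n + 1) h k l =
      (if h = 0 then 0 else pathCount n (h - 1) k l) +
      (if k = 0 then 0 else pathCount n h (k - 1) l) +
      (if l = 0 then 0 else pathCount n h k (l - 1)) := by
  have aux : ∀ a b : ℕ, (1 + a = b) = (b ≠ 0 ∧ a = b - 1) := fun a b =>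
    propext (by omega)
  unfold pathCount
  rw [← (Fin.consEquiv fun _ : Fin (n + 1) => Fin 3).sum_comp, Fintype.sum_prod_type,
    Fin.sum_univ_three]
  simp only [upCount_self_eq_sum, midCount_self_eq_sum, downCount, Fin.sum_univ_succ,
    Fin.consEquiv_apply, Fin.cons_zero, Fin.cons_succ]
  congr 1
  · congr 1
    · by_cases hh : h = 0 <;> simp [aux, hh]
    · by_cases hk : k = 0 <;> simp [aux, hk]
  · by_cases hl : l = 0 <;> simp [aux, hl]

theorem pathCount_mul_factorial (n : ℕ) : ∀ h k l : ℕ, h + k + l = n →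
    pathCount n h k l * (h.factorial * k.factorial * l.factorial) = n.factorial := by
  induction n with
  | zero =>
    intro h k l hs
    obtain ⟨rfl, rfl, rfl⟩ : h = 0 ∧ k = 0 ∧ l = 0 := by omega
    simp [pathCount, upCount, midCount, downCount]
  | succ n ih =>
    intro h k l hs
    have e₁ : (if h = 0 then 0 else pathCount n (h - 1) k l) *
        (h.factorial * k.factorial * l.factorial) = h * n.factorial := by
      rcases h with _ | h
      · simp
      · rw [← ih h k l (by omega)]
        simp [Nat.factorial_succ]
        ring
    have e₂ : (if k = 0 then 0 else pathCount n h (k - 1) l) *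
        (h.factorial * k.factorial * l.factorial) = k * n.factorial := by
      rcases k with _ | k
      · simp
      · rw [← ih h k l (by omega)]
        simp [Nat.factorial_succ]
        ring
    have e₃ : (if l = 0 then 0 else pathCount n h k (l - 1)) *
        (h.factorial * k.factorial * l.factorial) = l * n.factorial := by
      rcases l with _ | l
      · simp
      · rw [← ih h k l (by omega)]
        simp [Nat.factorial_succ]
        ring
    rw [pathCount_succ, add_mul, add_mul, e₁, e₂, e₃, ← add_mul, ← add_mul, hs,
      Nat.factorial_succ]

theorem card_counts_eq_triCoeff {n h k : ℕ} (hk : h + k ≤ n) :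
    (univ.filter fun ω : Fin n → Fin 3 => upCount n n ω = h ∧ midCount n n ω = k).card =
      triCoeff n h k := by
  have hT := pathCount_mul_factorial n h k (n - h - k) (by omega)
  rw [triCoeff, ← hT, Nat.mul_div_cancel _ (by positivity), card_filter, pathCount]
  refine sum_congr rfl fun ω _ => if_congr ?_ rfl rfl
  have := upCount_add_midCount_add_downCount n ω
  omega

theorem upCount_append_left (m r : ℕ) (a : Fin m → Fin 3) (b : Fin r → Fin 3) :
    upCount (m + r) m (Fin.append a b) = upCount m m a := by
  simp [upCount, card_filter, Fin.sum_univ_add, -sum_boole]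

theorem midCount_append_left (m r : ℕ) (a : Fin m → Fin 3) (b : Fin r → Fin 3) :
    midCount (m + r) m (Fin.append a b) = midCount m m a := by
  simp [midCount, card_filter, Fin.sum_univ_add, -sum_boole]

theorem upCount_append (m r : ℕ) (a : Fin m → Fin 3) (b : Fin r → Fin 3) :
    upCount (m + r) (m + r) (Fin.append a b) = upCount m m a + upCount r r b := by
  simp only [upCount_self_eq_sum, Fin.sum_univ_add, Fin.append_left, Fin.append_right]

theorem midCount_append (m r : ℕ) (a : Fin m → Fin 3) (b : Fin r → Fin 3) :
    midCount (m + r) (m + r) (Fin.append a b) = midCount m m a + midCount r r b := by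
  simp only [midCount_self_eq_sum, Fin.sum_univ_add, Fin.append_left, Fin.append_right]

theorem card_counts_two_times (m r i j h k : ℕ) (hij : i + j ≤ m) :
    (univ.filter fun ω : Fin (m + r) → Fin 3 =>
      (upCount (m + r) m ω = i ∧ midCount (m + r) m ω = j) ∧
        upCount (m + r) (m + r) ω = h ∧ midCount (m + r) (m + r) ω = k).card =
      if i ≤ h ∧ j ≤ k ∧ (h - i) + (k - j) ≤ r then
        triCoeff m i j * triCoeff r (h - i) (k - j) else 0 := by
  have hprod : (univ.filter fun ω : Fin (m + r) → Fin 3 =>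
      (upCount (m + r) m ω = i ∧ midCount (m + r) m ω = j) ∧
        upCount (m + r) (m + r) ω = h ∧ midCount (m + r) (m + r) ω = k).card =
      ((univ.filter fun a : Fin m → Fin 3 => upCount m m a = i ∧ midCount m m a = j) ×ˢ
        (univ.filter fun b : Fin r → Fin 3 =>
          i + upCount r r b = h ∧ j + midCount r r b = k)).card := by
    symm
    refine card_equiv (Fin.appendEquiv m r) fun ⟨a, b⟩ => ?_
    simp only [mem_product, mem_filter, mem_univ, true_and, Fin.appendEquiv, Equiv.coe_fn_mk,
      upCount_append_left, midCount_append_left, upCount_append, midCount_append]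
    constructor
    · rintro ⟨⟨rfl, rfl⟩, h₁, h₂⟩
      exact ⟨⟨rfl, rfl⟩, h₁, h₂⟩
    · rintro ⟨⟨rfl, rfl⟩, h₁, h₂⟩
      exact ⟨⟨rfl, rfl⟩, h₁, h₂⟩
  rw [hprod, card_product, card_counts_eq_triCoeff hij]
  split_ifs with hc
  · rw [← card_counts_eq_triCoeff hc.2.2]
    congr 2
    ext b
    simp only [mem_filter, mem_univ, true_and]
    omega
  · rw [filter_eq_empty_iff.mpr, card_empty, mul_zero]
    intro b _ hb
    have := upCount_add_midCount_add_downCount r b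
    omega

/-- On a set of paths with the same terminal counts the weight is constant. -/
theorem sum_triWeight_filter (n : ℕ) (p₁ p₂ p₃ : ℝ) (A : Finset (Fin n → Fin 3)) (h k : ℕ) :
    ∑ ω ∈ A.filter (fun ω => upCount n n ω = h ∧ midCount n n ω = k),
        triWeight n p₁ p₂ p₃ ω =
      (A.filter fun ω => upCount n n ω = h ∧ midCount n n ω = k).card *
        (p₁ ^ h * p₂ ^ k * p₃ ^ (n - h - k)) := by
  rw [← nsmul_eq_mul]
  refine sum_eq_card_nsmul fun ω hω => ?_
  obtain ⟨-, rfl, rfl⟩ := mem_filter.mp hω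
  have := upCount_add_midCount_add_downCount n ω
  rw [triWeight_eq_pow]
  congr 2
  omega

/-- In the trinomial weak-information setup with horizon `n`, for `m ≤ n` and `i + j ≤ m`,
`P^ν(U_m = i ∧ M_m = j)
  = Σ_{(h,k)} ν(h,k) · C(m; i,j) · C(n-m; h-i,k-j) / C(n; h,k)`,
the sum being over `h + k ≤ n`, `i ≤ h`, `j ≤ k`, `(h-i)+(k-j) ≤ n-m`. -/
theorem stmt_10 (n : ℕ) (p₁ p₂ p₃ : ℝ)
    (hp₁ : 0 < p₁) (hp₂ : 0 < p₂) (hp₃ : 0 < p₃) (hpsum : p₁ + p₂ + p₃ = 1)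
    (ν : ℕ → ℕ → ℝ) (hν_nonneg : ∀ h k, 0 ≤ ν h k)
    (hν_sum : ∑ h ∈ range (n + 1), ∑ k ∈ range (n + 1 - h), ν h k = 1)
    (m i j : ℕ) (hm : m ≤ n) (hij : i + j ≤ m) :
    triPnu n p₁ p₂ p₃ ν
        (univ.filter (fun ω => upCount n m ω = i ∧ midCount n m ω = j)) =
      ∑ h ∈ range (n + 1), ∑ k ∈ range (n + 1),
        if i ≤ h ∧ j ≤ k ∧ h + k ≤ n ∧ (h - i) + (k - j) ≤ n - m then
          ν h k * (triCoeff m i j * triCoeff (n - m) (h - i) (k - j) : ℝ) /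
            (triCoeff n h k : ℝ)
        else 0 := by
  obtain ⟨r, rfl⟩ := Nat.exists_eq_add_of_le hm
  rw [triPnu]
  refine sum_congr rfl fun h hh => ?_
  rw [mem_range] at hh
  rw [← sum_subset (range_mono (Nat.sub_le (m + r + 1) h))]
  · refine sum_congr rfl fun k hk => ?_
    rw [mem_range] at hk
    have hhk : h + k ≤ m + r := by omega
    have hw : p₁ ^ h * p₂ ^ k * p₃ ^ (m + r - h - k) ≠ 0 := by positivity
    rw [sum_triWeight_filter, sum_triWeight_filter, card_counts_eq_triCoeff hhk, ← mul_assoc,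
      mul_div_mul_right _ _ hw, filter_filter, card_counts_two_times m r i j h k hij,
      Nat.add_sub_cancel_left]
    simp only [hhk, true_and]
    split_ifs <;> simp
  · intro k _ hk
    rw [mem_range] at hk
    exact if_neg fun hc => hk (by omega)
end

section
/- Multinomial weak-information setup: fix n ≥ 1, K ≥ 1, let Ω_n = (Fin n → Fin K), fix p : Fin K → ℝ with p(a) > 0 for all a and Σ_a p(a) = 1, and let P̃ be the product probability measure on Ω_n giving each coordinate the weights p. For 0 ≤ m ≤ n let N_m(ω) : Fin K → ℕ be the count vector N_m(ω)(a) := #{j < m : ω(j) = a}. Let ν be a probability weight function on count vectors w : Fin K → ℕ with Σ_a w(a) = n, and define P^ν(A) := Σ_w ν(w) · P̃(A ∩ {N_n = w}) / P̃(N_n = w). Then for every 0 ≤ m ≤ n and every v : Fin K → ℕ with Σ_a v(a) = m, P^ν(N_m = v) = Σ_{w : Σ_a w(a) = n, v(a) ≤ w(a) ∀a} ν(w) · M(v) · M(w - v) / M(w), where M(u) := (Σ_a u(a))! / Π_a (u(a)!) is the multinomial coefficient of the vector u and w - v is the componentwise difference. -/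
open Finset

/-- The count vector of the first `m` steps of a path `ω`: `countVec n K m ω a` is the
number of steps `j < m` with `ω j = a`. -/
def countVec (n K m : ℕ) (ω : Fin n → Fin K) : Fin K → ℕ :=
  fun a => (univ.filter (fun j : Fin n => (j : ℕ) < m ∧ ω j = a)).card

/-- The product probability weight of a multinomial path `ω`, each step having weights
`p : Fin K → ℝ`. -/
noncomputable def multWeight (n K : ℕ) (p : Fin K → ℝ) (ω : Fin n → Fin K) : ℝ :=
  ∏ j, p (ω j)

/-- The minimal probability measure associated with the weak information `ν` in the
multinomial model with horizon `n`:
`P^ν(A) = Σ_w ν(w) · P̃(A ∩ {N_n = w}) / P̃(N_n = w)`, the sum being over count vectors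
`w` with `Σ_a w(a) = n`. -/
noncomputable def multPnu (n K : ℕ) (p : Fin K → ℝ) (ν : (Fin K → ℕ) → ℝ)
    (A : Finset (Fin n → Fin K)) : ℝ :=
  ∑ w ∈ Finset.Nat.antidiagonalTuple K n,
    ν w *
      (∑ ω ∈ A.filter (fun ω => countVec n K n ω = w), multWeight n K p ω) /
      (∑ ω ∈ univ.filter (fun ω => countVec n K n ω = w), multWeight n K p ω)

lemma countVec_eq_sum (n K m : ℕ) (ω : Fin n → Fin K) (a : Fin K) :
    countVec n K m ω a = ∑ j : Fin n, if (j : ℕ) < m ∧ ω j = a then 1 else 0 := by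
  simp only [countVec, card_filter]

lemma countVec_append_left (m k K : ℕ) (f : Fin m → Fin K) (g : Fin k → Fin K) :
    countVec (m + k) K m (Fin.append f g) = countVec m K m f := by
  ext a
  rw [countVec_eq_sum, Fin.sum_univ_add]
  simp [countVec]

lemma countVec_append (m k K : ℕ) (f : Fin m → Fin K) (g : Fin k → Fin K) :
    countVec (m + k) K (m + k) (Fin.append f g) = countVec m K m f + countVec k K k g := by
  ext a
  have h (i : Fin m) : (i : ℕ) < m + k := by omega
  rw [countVec_eq_sum, Fin.sum_univ_add]
  simp [countVec, h]

/-- The weight of a path depends only on its final count vector. -/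
lemma multWeight_eq_prod_pow (n K : ℕ) (p : Fin K → ℝ) (ω : Fin n → Fin K) :
    multWeight n K p ω = ∏ a, p a ^ countVec n K n ω a := by
  rw [multWeight, ← Finset.prod_fiberwise' univ ω p]
  simp [countVec]

/-- The number of paths of length `n` with count vector `w` is the multinomial coefficient. -/
lemma card_countVec_eq (n K : ℕ) (w : Fin K → ℕ) (hw : ∑ a, w a = n) :
    #{ω : Fin n → Fin K | countVec n K n ω = w} = Nat.multinomial univ w := by
  classical
  set d : Fin K →₀ ℕ := Finsupp.equivFunOnFinite.symm w with hd
  have key := MvPolynomial.coeff_sum_X_pow_of_fintype (R := ℕ) d n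
  have hsum : d.sum (fun _ m ↦ m) = n := by
    rw [Finsupp.sum_fintype _ _ (by simp)]
    simpa [hd] using hw
  rw [if_pos hsum, Finsupp.multinomial_eq_of_support_subset (subset_univ _)] at key
  have hdw : (d : Fin K → ℕ) = w := by simp [hd]
  rw [hdw, Nat.cast_id] at key
  rw [← key, Fintype.sum_pow, MvPolynomial.coeff_sum, card_filter]
  refine sum_congr rfl fun ω _ ↦ ?_
  have hmon : (∏ i, MvPolynomial.X (ω i) : MvPolynomial (Fin K) ℕ) =
      MvPolynomial.monomial (Finsupp.equivFunOnFinite.symm (countVec n K n ω)) 1 := by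
    rw [← Finset.prod_fiberwise' univ ω MvPolynomial.X, MvPolynomial.monomial_eq,
      Finsupp.prod_fintype _ _ (by simp)]
    simp [countVec]
  rw [hmon, MvPolynomial.coeff_monomial, hd]
  simp only [EmbeddingLike.apply_eq_iff_eq]

/-- The number of paths of length `m + k` with count vector `v` after `m` steps and `w` at the
end. -/
lemma card_countVec_eq_and_countVec_eq (m k K : ℕ) (v w : Fin K → ℕ) (hv : ∑ a, v a = m)
    (hw : ∑ a, w a = m + k) :
    #{ω : Fin (m + k) → Fin K | countVec (m + k) K m ω = v ∧ countVec (m + k) K (m + k) ω = w} =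
      if ∀ a, v a ≤ w a then Nat.multinomial univ v * Nat.multinomial univ (w - v) else 0 := by
  have hcard : #{ω : Fin (m + k) → Fin K |
        countVec (m + k) K m ω = v ∧ countVec (m + k) K (m + k) ω = w} =
      #{fg : (Fin m → Fin K) × (Fin k → Fin K) |
        countVec m K m fg.1 = v ∧ v + countVec k K k fg.2 = w} := by
    refine (card_equiv (Fin.appendEquiv m k) fun fg ↦ ?_).symm
    change fg ∈ _ ↔ Fin.append fg.1 fg.2 ∈ _
    simp only [mem_filter, mem_univ, true_and, countVec_append_left, countVec_append]
    exact and_congr_right fun h ↦ by rw [h]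
  rw [hcard]
  split_ifs with h
  · have hk : ∑ a, (w - v) a = k := by
      have : ∑ a, ((w - v) a + v a) = m + k := by
        rw [← hw]
        exact sum_congr rfl fun a _ ↦ Nat.sub_add_cancel (h a)
      rw [sum_add_distrib, hv] at this
      omega
    rw [← card_countVec_eq m K v hv, ← card_countVec_eq k K (w - v) hk, ← card_product,
      ← filter_product, univ_product_univ]
    congr 1
    refine filter_congr fun fg _ ↦ and_congr_right fun _ ↦ ?_
    rw [eq_tsub_iff_add_eq_of_le (show v ≤ w from h), add_comm]
  · rw [card_eq_zero, filter_eq_empty_iff]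
    rintro fg - ⟨-, rfl⟩
    exact h fun a ↦ Nat.le_add_right _ _

/-- In the multinomial weak-information setup with horizon `n`, for `m ≤ n` and every
count vector `v` with `Σ_a v(a) = m`,
`P^ν(N_m = v) = Σ_{w : Σ w = n, v ≤ w} ν(w) · M(v) · M(w - v) / M(w)`,
where `M(u)` is the multinomial coefficient of the vector `u`. -/
theorem stmt_12 (n K : ℕ) (hn : 1 ≤ n) (hK : 1 ≤ K)
    (p : Fin K → ℝ) (hp_pos : ∀ a, 0 < p a) (hp_sum : ∑ a, p a = 1)
    (ν : (Fin K → ℕ) → ℝ) (hν_nonneg : ∀ w, 0 ≤ ν w)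
    (hν_sum : ∑ w ∈ Finset.Nat.antidiagonalTuple K n, ν w = 1)
    (m : ℕ) (hm : m ≤ n) (v : Fin K → ℕ) (hv : ∑ a, v a = m) :
    multPnu n K p ν (univ.filter (fun ω => countVec n K m ω = v)) =
      ∑ w ∈ Finset.Nat.antidiagonalTuple K n,
        if ∀ a, v a ≤ w a then
          ν w * (Nat.multinomial univ v * Nat.multinomial univ (w - v) : ℝ) /
            (Nat.multinomial univ w : ℝ)
        else 0 := by
  obtain ⟨k, rfl⟩ := Nat.exists_eq_add_of_le hm
  refine sum_congr rfl fun w hw ↦ ?_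
  rw [Finset.Nat.mem_antidiagonalTuple] at hw
  have hweight (s : Finset (Fin (m + k) → Fin K))
      (hs : ∀ ω ∈ s, countVec (m + k) K (m + k) ω = w) :
      ∑ ω ∈ s, multWeight (m + k) K p ω = #s * ∏ a, p a ^ w a := by
    rw [← nsmul_eq_mul]
    exact sum_eq_card_nsmul fun ω hω ↦ by rw [multWeight_eq_prod_pow, hs ω hω]
  have hprod : ∏ a, p a ^ w a ≠ 0 := (prod_pos fun a _ ↦ pow_pos (hp_pos a) _).ne'
  rw [hweight _ fun ω hω ↦ (mem_filter.mp hω).2, hweight _ fun ω hω ↦ (mem_filter.mp hω).2,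
    filter_filter, card_countVec_eq_and_countVec_eq m k K v w hv hw, card_countVec_eq _ K w hw,
    ← mul_assoc, mul_div_mul_right _ _ hprod]
  split_ifs <;> simp
end

section
/- In the trinomial weak-information setup with horizon n, the path process is Markov under P^ν in the following sense: for every 0 ≤ m < n, every a ∈ Fin 3, and any two prefixes σ, σ' : Fin m → Fin 3 having the same counts (#{j : σ(j) = 0} = #{j : σ'(j) = 0} and #{j : σ(j) = 1} = #{j : σ'(j) = 1}), if P^ν(Cyl σ) > 0 and P^ν(Cyl σ') > 0, then P^ν(Cyl σ ∩ {ω(m) = a}) / P^ν(Cyl σ) = P^ν(Cyl σ' ∩ {ω(m) = a}) / P^ν(Cyl σ'), where Cyl σ := {ω ∈ Ω_n : ω(j) = σ(j) for all j < m}. Consequently, under P^ν the conditional distribution of the next price move given the whole past depends only on the current value of the price process S_m = a^{U_m} b^{M_m} c^{m-U_m-M_m} s. -/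
open Finset

/-- `triPnu` is invariant under permutations of the time steps. -/
theorem triPnu_congr_of_perm (n : ℕ) (p₁ p₂ p₃ : ℝ) (ν : ℕ → ℕ → ℝ)
    (e : Equiv.Perm (Fin n)) (A B : Finset (Fin n → Fin 3))
    (hAB : ∀ ω, ω ∈ A ↔ ω ∘ e ∈ B) :
    triPnu n p₁ p₂ p₃ ν A = triPnu n p₁ p₂ p₃ ν B := by
  have hU (ω : Fin n → Fin 3) : upCount n n (ω ∘ e) = upCount n n ω :=
    card_equiv e (by simp)
  have hM (ω : Fin n → Fin 3) : midCount n n (ω ∘ e) = midCount n n ω :=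
    card_equiv e (by simp)
  have hW (ω : Fin n → Fin 3) : triWeight n p₁ p₂ p₃ (ω ∘ e) = triWeight n p₁ p₂ p₃ ω :=
    Equiv.prod_comp e fun j => ![p₁, p₂, p₃] (ω j)
  unfold triPnu
  refine sum_congr rfl fun h _ => sum_congr rfl fun k _ => ?_
  congr 2
  refine sum_equiv (e.symm.arrowCongr (Equiv.refl (Fin 3))) (fun ω => ?_) fun ω _ => ?_
  · change _ ↔ ω ∘ e ∈ _
    simp only [mem_filter, hAB, hU, hM]
  · exact (hW ω).symm

/-- Two `Fin 3`-valued words in which `0` and `1` occur equally often are permutations of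
each other. -/
theorem exists_perm_comp_eq_of_card_eq {m : ℕ} (σ σ' : Fin m → Fin 3)
    (h0 : #{j | σ j = 0} = #{j | σ' j = 0}) (h1 : #{j | σ j = 1} = #{j | σ' j = 1}) :
    ∃ e : Equiv.Perm (Fin m), ∀ j, σ (e j) = σ' j := by
  have hsum (τ : Fin m → Fin 3) :
      #{j | τ j = 0} + #{j | τ j = 1} + #{j | τ j = 2} = m := by
    have := card_eq_sum_card_fiberwise (f := τ) (s := univ) (t := univ) (by simp)
    simpa [Fin.sum_univ_three] using this.symm
  have h (c : Fin 3) : #{j | σ' j = c} = #{j | σ j = c} := by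
    have := hsum σ
    have := hsum σ'
    fin_cases c <;> simp only [Fin.zero_eta, Fin.mk_one, Fin.reduceFinMk] <;> omega
  have hE (c : Fin 3) : Nonempty ({j // σ' j = c} ≃ {j // σ j = c}) := by
    rw [← Fintype.card_eq, Fintype.card_subtype, Fintype.card_subtype, h]
  exact ⟨Equiv.ofFiberEquiv fun c => (hE c).some, fun j => Equiv.ofFiberEquiv_map _ j⟩

/-- A permutation of the first `m` of `n` indices extends to one fixing all later indices. -/
theorem exists_perm_extend_castLE {m n : ℕ} (h : m ≤ n) (e : Equiv.Perm (Fin m)) :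
    ∃ E : Equiv.Perm (Fin n), (∀ j, E (Fin.castLE h j) = Fin.castLE h (e j)) ∧
      ∀ i : Fin n, m ≤ i → E i = i := by
  let f : Fin m ≃ {i : Fin n // (i : ℕ) < m} :=
    ⟨fun j => ⟨j.castLE h, j.2⟩, fun i => ⟨i.1, i.2⟩, fun _ => rfl, fun _ => rfl⟩
  exact ⟨e.extendDomain f, fun j => e.extendDomain_apply_image f j,
    fun i hi => e.extendDomain_apply_not_subtype f hi.not_gt⟩

/-- Markov property of the trinomial walk under the minimal weak-information measure:
for two prefixes `σ, σ'` of length `m < n` with the same up- and middle-counts and whose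
cylinders have positive `P^ν`-probability, the conditional probability of the next move
`a` given the past is the same, i.e. it depends on the path only through the current
value of the price process. -/
theorem stmt_13 (n : ℕ) (p₁ p₂ p₃ : ℝ)
    (hp₁ : 0 < p₁) (hp₂ : 0 < p₂) (hp₃ : 0 < p₃) (hpsum : p₁ + p₂ + p₃ = 1)
    (ν : ℕ → ℕ → ℝ) (hν_nonneg : ∀ h k, 0 ≤ ν h k)
    (hν_sum : ∑ h ∈ range (n + 1), ∑ k ∈ range (n + 1 - h), ν h k = 1)
    (m : ℕ) (hm : m < n) (a : Fin 3)
    (σ σ' : Fin m → Fin 3)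
    (hcount0 : (univ.filter (fun j : Fin m => σ j = 0)).card =
      (univ.filter (fun j : Fin m => σ' j = 0)).card)
    (hcount1 : (univ.filter (fun j : Fin m => σ j = 1)).card =
      (univ.filter (fun j : Fin m => σ' j = 1)).card)
    (hpos : 0 < triPnu n p₁ p₂ p₃ ν
      (univ.filter (fun ω => ∀ j : Fin m, ω (j.castLE hm.le) = σ j)))
    (hpos' : 0 < triPnu n p₁ p₂ p₃ ν
      (univ.filter (fun ω => ∀ j : Fin m, ω (j.castLE hm.le) = σ' j))) :
    triPnu n p₁ p₂ p₃ ν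
        (univ.filter (fun ω =>
          (∀ j : Fin m, ω (j.castLE hm.le) = σ j) ∧ ω ⟨m, hm⟩ = a)) /
      triPnu n p₁ p₂ p₃ ν
        (univ.filter (fun ω => ∀ j : Fin m, ω (j.castLE hm.le) = σ j)) =
    triPnu n p₁ p₂ p₃ ν
        (univ.filter (fun ω =>
          (∀ j : Fin m, ω (j.castLE hm.le) = σ' j) ∧ ω ⟨m, hm⟩ = a)) /
      triPnu n p₁ p₂ p₃ ν
        (univ.filter (fun ω => ∀ j : Fin m, ω (j.castLE hm.le) = σ' j)) := by
  obtain ⟨e, he⟩ := exists_perm_comp_eq_of_card_eq σ σ' hcount0 hcount1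
  obtain ⟨E, hE, hE_fix⟩ := exists_perm_extend_castLE hm.le e
  have hcyl (ω : Fin n → Fin 3) : (∀ j : Fin m, ω (j.castLE hm.le) = σ j) ↔
      ∀ j : Fin m, (ω ∘ E) (j.castLE hm.le) = σ' j := by
    simp only [Function.comp_apply, hE, ← he]
    exact e.forall_congr_right.symm
  congr 1
  · refine triPnu_congr_of_perm n p₁ p₂ p₃ ν E _ _ fun ω => ?_
    simp only [mem_filter, mem_univ, true_and, hcyl ω, Function.comp_apply,
      hE_fix ⟨m, hm⟩ le_rfl]
  · refine triPnu_congr_of_perm n p₁ p₂ p₃ ν E _ _ fun ω => ?_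
    simp only [mem_filter, mem_univ, true_and, hcyl ω]
end

section
/- Let Ω be a nonempty finite set and let P̃ and P^ν be probability weight functions on Ω with P̃(ω) > 0 and P^ν(ω) > 0 for all ω. Let U : (0,∞) → ℝ be a utility function with I := (U')⁻¹ : (0,∞) → (0,∞), let c > 0 (the discount factor (1+r)^n), let x > 0, and suppose Λ > 0 satisfies the budget equation Σ_ω P̃(ω) · c⁻¹ · I(Λ c⁻¹ · P̃(ω)/P^ν(ω)) = x. Define the candidate optimal terminal wealth V*(ω) := I(Λ c⁻¹ · P̃(ω)/P^ν(ω)). Then for every function V : Ω → (0,∞) satisfying the budget constraint Σ_ω P̃(ω) · c⁻¹ · V(ω) = x, one has Σ_ω P^ν(ω) U(V(ω)) ≤ Σ_ω P^ν(ω) U(V*(ω)). Hence the financial value of the weak information in the complete discrete market, u(x, ν) = max over budget-feasible claims of E_{P^ν}[U(V)], equals E_{P^ν}[U(I(Λ c⁻¹ · dP̃/dP^ν))]. -/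
open Finset Set

/-- A concave function lies below its tangent lines. -/
theorem ConcaveOn.le_tangent_of_hasDerivAt {S : Set ℝ} {f : ℝ → ℝ} {f' a v : ℝ}
    (hf : ConcaveOn ℝ S f) (ha : a ∈ S) (hv : v ∈ S) (hd : HasDerivAt f f' a) :
    f v ≤ f a + f' * (v - a) := by
  rcases lt_trichotomy a v with h | rfl | h
  · have hs := hf.slope_le_of_hasDerivAt ha hv h hd
    rw [slope_def_field, div_le_iff₀ (sub_pos.2 h)] at hs
    linarith
  · simp
  · have hs := hf.le_slope_of_hasDerivAt hv ha h hd
    rw [slope_def_field, le_div_iff₀ (sub_pos.2 h)] at hs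
    linarith

/-- In a finite complete market with unique martingale measure `P̃`, discount factor
`c = (1+r)^n` and minimal weak-information measure `P^ν`, the claim
`V*(ω) = I(Λ c⁻¹ · P̃(ω)/P^ν(ω))` (with `Λ` the Lagrange multiplier of the budget
constraint) maximizes `E_{P^ν}[U(V)]` over all budget-feasible terminal wealths `V`. -/
theorem stmt_14 {Ω : Type*} [Fintype Ω] [Nonempty Ω]
    (Pt : Ω → ℝ) (hPt_pos : ∀ ω, 0 < Pt ω) (hPt_sum : ∑ ω, Pt ω = 1)
    (Pν : Ω → ℝ) (hPν_pos : ∀ ω, 0 < Pν ω) (hPν_sum : ∑ ω, Pν ω = 1)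
    -- the utility function `U` with derivative `U'` and `I := (U')⁻¹`
    (U U' I : ℝ → ℝ)
    (hU_incr : StrictMonoOn U (Ioi (0 : ℝ)))
    (hU_conc : StrictConcaveOn ℝ (Ioi (0 : ℝ)) U)
    (hU_deriv : ∀ z ∈ Ioi (0 : ℝ), HasDerivAt U (U' z) z)
    (hInada_top : Filter.Tendsto U' Filter.atTop (nhds 0))
    (hInada_zero : Filter.Tendsto U' (nhdsWithin 0 (Ioi 0)) Filter.atTop)
    (hI_pos : ∀ z ∈ Ioi (0 : ℝ), I z ∈ Ioi (0 : ℝ))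
    (hI_inv : ∀ z ∈ Ioi (0 : ℝ), U' (I z) = z)
    (hI_inv' : ∀ z ∈ Ioi (0 : ℝ), I (U' z) = z)
    -- discount factor, initial capital and Lagrange multiplier
    (c : ℝ) (hc : 0 < c) (x : ℝ) (hx : 0 < x) (Λ : ℝ) (hΛ : 0 < Λ)
    (hbudget : ∑ ω, Pt ω * c⁻¹ * I (Λ * c⁻¹ * (Pt ω / Pν ω)) = x)
    -- a budget-feasible positive terminal wealth
    (V : Ω → ℝ) (hV_pos : ∀ ω, 0 < V ω)
    (hV_budget : ∑ ω, Pt ω * c⁻¹ * V ω = x) :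
    ∑ ω, Pν ω * U (V ω) ≤ ∑ ω, Pν ω * U (I (Λ * c⁻¹ * (Pt ω / Pν ω))) := by
  have pointwise (ω : Ω) : Pν ω * U (V ω) ≤
      Pν ω * U (I (Λ * c⁻¹ * (Pt ω / Pν ω))) +
        Λ * (Pt ω * c⁻¹ * V ω - Pt ω * c⁻¹ * I (Λ * c⁻¹ * (Pt ω / Pν ω))) := by
    have hν := hPν_pos ω
    have hy : Λ * c⁻¹ * (Pt ω / Pν ω) ∈ Ioi (0 : ℝ) :=
      mul_pos (mul_pos hΛ (inv_pos.2 hc)) (div_pos (hPt_pos ω) hν)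
    have htangent := hU_conc.concaveOn.le_tangent_of_hasDerivAt (hI_pos _ hy) (hV_pos ω)
      (hU_deriv _ (hI_pos _ hy))
    rw [hI_inv _ hy] at htangent
    have hcancel : Pν ω * (Λ * c⁻¹ * (Pt ω / Pν ω)) = Λ * (Pt ω * c⁻¹) := by
      field_simp
    calc Pν ω * U (V ω) ≤ _ := mul_le_mul_of_nonneg_left htangent hν.le
      _ = _ := by rw [mul_add, ← mul_assoc, hcancel]; ring
  refine (Finset.sum_le_sum fun ω _ => pointwise ω).trans_eq ?_
  rw [Finset.sum_add_distrib, ← Finset.mul_sum, Finset.sum_sub_distrib, hV_budget, hbudget,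
    sub_self, mul_zero, add_zero]
end

section
/- Let X be a Polish space, let (P_n)_{n≥1} be Borel probability measures on X converging weakly to a Borel probability measure P, and let ξ_n, ξ : X → [0,∞) be continuous functions with sup_{n≥1} ‖ξ_n‖_∞ < ∞, ξ bounded, and ξ_n → ξ uniformly on every compact subset of X. Let x > 0 and extend t ↦ t·ln t to [0,∞) by the value 0 at t = 0 (so that it is continuous). Then the logarithmic-utility financial values of weak information converge: ln x + ∫_X ξ_n(y)·ln ξ_n(y) P_n(dy) → ln x + ∫_X ξ(y)·ln ξ(y) P(dy) as n → ∞. -/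
open MeasureTheory Filter Topology

namespace MeasureTheory

variable {X : Type*} [TopologicalSpace X] [PolishSpace X] [MeasurableSpace X] [BorelSpace X]

/-- A weakly convergent sequence of probability measures on a Polish space is tight. -/
theorem ProbabilityMeasure.isTightMeasureSet_range_of_tendsto {P : ℕ → ProbabilityMeasure X}
    {P₀ : ProbabilityMeasure X} (h : Tendsto P atTop (𝓝 P₀)) :
    IsTightMeasureSet (Set.range fun n => (P n : Measure X)) := by
  let := TopologicalSpace.upgradeIsCompletelyMetrizable X
  have hcomp : IsCompact (closure (Set.range P)) :=
    h.isCompact_insert_range.closure_of_subset (Set.subset_insert _ _)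
  refine (isTightMeasureSet_of_isCompact_closure hcomp).subset ?_
  rintro _ ⟨n, rfl⟩
  exact ⟨P n, ⟨n, rfl⟩, rfl⟩

/-- If uniformly bounded continuous functions converge uniformly on compact sets, their integrals
against a tight sequence of probability measures are asymptotically those of the limit. -/
theorem tendsto_integral_sub_of_isTightMeasureSet {P : ℕ → Measure X}
    [∀ n, IsProbabilityMeasure (P n)] (htight : IsTightMeasureSet (Set.range P))
    {f : ℕ → X → ℝ} {f₀ : X → ℝ} {C : ℝ} (hf : ∀ n, Continuous (f n)) (hf₀ : Continuous f₀)
    (hfC : ∀ n y, ‖f n y‖ ≤ C) (hf₀C : ∀ y, ‖f₀ y‖ ≤ C)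
    (hunif : ∀ K : Set X, IsCompact K → TendstoUniformlyOn f f₀ atTop K) :
    Tendsto (fun n => ∫ y, (f n y - f₀ y) ∂(P n)) atTop (𝓝 0) := by
  rw [Metric.tendsto_atTop']
  intro ε hε
  have hC : 0 ≤ C := by
    obtain ⟨y⟩ := (P 0).nonempty_of_neZero
    exact (norm_nonneg _).trans (hf₀C y)
  set δ : ℝ := ε / (2 * (2 * C + 1)) with hδ
  have hδ_pos : 0 < δ := by positivity
  obtain ⟨K, hK, hKδ⟩ := isTightMeasureSet_iff_exists_isCompact_measure_compl_le.mp htight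
    (ENNReal.ofReal δ) (by simpa using hδ_pos)
  obtain ⟨N, hN⟩ := eventually_atTop.mp
    (Metric.tendstoUniformlyOn_iff.mp (hunif K hK) (ε / 2) (by positivity))
  refine ⟨N, fun n hn => ?_⟩
  have hint : Integrable (fun y => f n y - f₀ y) (P n) :=
    (Integrable.of_bound (hf n).aestronglyMeasurable C (.of_forall (hfC n))).sub
      (Integrable.of_bound hf₀.aestronglyMeasurable C (.of_forall hf₀C))
  have hin : ‖∫ y in K, (f n y - f₀ y) ∂(P n)‖ ≤ ε / 2 * (P n).real K :=
    norm_setIntegral_le_of_norm_le_const (measure_lt_top _ _) fun y hy => by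
      simpa [dist_eq_norm, norm_sub_rev] using (hN n hn.le y hy).le
  have hout : ‖∫ y in Kᶜ, (f n y - f₀ y) ∂(P n)‖ ≤ 2 * C * (P n).real Kᶜ :=
    norm_setIntegral_le_of_norm_le_const (measure_lt_top _ _) fun y _ => by
      linarith [norm_sub_le (f n y) (f₀ y), hfC n y, hf₀C y]
  have hKc : (P n).real Kᶜ ≤ δ := ENNReal.toReal_le_of_le_ofReal hδ_pos.le (hKδ _ ⟨n, rfl⟩)
  rw [dist_zero_right, ← integral_add_compl hK.measurableSet hint]
  calc _ ≤ ε / 2 * (P n).real K + 2 * C * (P n).real Kᶜ :=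
        (norm_add_le _ _).trans (add_le_add hin hout)
    _ ≤ ε / 2 * 1 + 2 * C * δ := by gcongr; exact measureReal_le_one
    _ < ε / 2 + (2 * C + 1) * δ := by linarith
    _ = ε := by rw [hδ]; field_simp; ring

/-- Integrals of uniformly bounded continuous functions converging uniformly on compact sets
converge along a weakly convergent sequence of probability measures. -/
theorem ProbabilityMeasure.tendsto_integral_of_tendstoUniformlyOn {P : ℕ → ProbabilityMeasure X}
    {P₀ : ProbabilityMeasure X} (h : Tendsto P atTop (𝓝 P₀))
    {f : ℕ → X → ℝ} {f₀ : X → ℝ} {C : ℝ} (hf : ∀ n, Continuous (f n)) (hf₀ : Continuous f₀)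
    (hfC : ∀ n y, ‖f n y‖ ≤ C) (hf₀C : ∀ y, ‖f₀ y‖ ≤ C)
    (hunif : ∀ K : Set X, IsCompact K → TendstoUniformlyOn f f₀ atTop K) :
    Tendsto (fun n => ∫ y, f n y ∂(P n : Measure X)) atTop
      (𝓝 (∫ y, f₀ y ∂(P₀ : Measure X))) := by
  have hdiff := tendsto_integral_sub_of_isTightMeasureSet
    (isTightMeasureSet_range_of_tendsto h) hf hf₀ hfC hf₀C hunif
  have hlim := tendsto_iff_forall_integral_tendsto.mp h
    (BoundedContinuousFunction.ofNormedAddCommGroup f₀ hf₀ C hf₀C)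
  refine (by simpa using hdiff.add hlim : Tendsto _ _ _).congr fun n => ?_
  rw [integral_sub (Integrable.of_bound (hf n).aestronglyMeasurable C (.of_forall (hfC n)))
      (Integrable.of_bound hf₀.aestronglyMeasurable C (.of_forall hf₀C))]
  simp

end MeasureTheory

/-- Composing with a function continuous on a compact set preserves uniform convergence of
functions valued in that set. -/
theorem TendstoUniformlyOn.comp_continuousOn_isCompact {α β γ ι : Type*} [UniformSpace β]
    [UniformSpace γ] {p : Filter ι} {F : ι → α → β} {f : α → β} {s : Set α} {t : Set β}
    {g : β → γ} (h : TendstoUniformlyOn F f p s) (ht : IsCompact t) (hg : ContinuousOn g t)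
    (hF : ∀ i y, F i y ∈ t) (hf : ∀ y, f y ∈ t) :
    TendstoUniformlyOn (fun i y => g (F i y)) (fun y => g (f y)) p s := by
  intro u hu
  have huc := mem_inf_principal.mp (ht.uniformContinuousOn_of_continuous hg hu)
  filter_upwards [h _ huc] with i hi y hy
  exact hi y hy ⟨hf y, hF i y⟩

/-- Convergence of the logarithmic-utility (`U(x) = ln x`) financial values of weak
information: `ln x + ∫ ξ_n·ln ξ_n dP_n → ln x + ∫ ξ·ln ξ dP` (here `Real.log 0 = 0`, so
`t ↦ t·ln t` is automatically extended by `0` at `t = 0`). -/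
theorem stmt_16 {X : Type*} [TopologicalSpace X] [PolishSpace X]
    [MeasurableSpace X] [BorelSpace X]
    (P : ℕ → Measure X) (P₀ : Measure X)
    [∀ n, IsProbabilityMeasure (P n)] [IsProbabilityMeasure P₀]
    (hweak : ∀ g : BoundedContinuousFunction X ℝ,
      Tendsto (fun n => ∫ y, g y ∂(P n)) atTop (𝓝 (∫ y, g y ∂P₀)))
    (ξ : ℕ → X → ℝ) (ξ₀ : X → ℝ)
    (hξ_nonneg : ∀ n y, 0 ≤ ξ n y) (hξ₀_nonneg : ∀ y, 0 ≤ ξ₀ y)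
    (hξ_cont : ∀ n, Continuous (ξ n)) (hξ₀_cont : Continuous ξ₀)
    (B : ℝ) (hξ_bdd : ∀ n y, ξ n y ≤ B) (hξ₀_bdd : ∀ y, ξ₀ y ≤ B)
    (hunif : ∀ K : Set X, IsCompact K → TendstoUniformlyOn (fun n y => ξ n y) ξ₀ atTop K)
    (x : ℝ) (hx : 0 < x) :
    Tendsto
      (fun n => Real.log x + ∫ y, ξ n y * Real.log (ξ n y) ∂(P n)) atTop
      (𝓝 (Real.log x + ∫ y, ξ₀ y * Real.log (ξ₀ y) ∂P₀)) := by
  let Q : ℕ → ProbabilityMeasure X := fun n => ⟨P n, inferInstance⟩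
  let Q₀ : ProbabilityMeasure X := ⟨P₀, inferInstance⟩
  have hQ : Tendsto Q atTop (𝓝 Q₀) :=
    ProbabilityMeasure.tendsto_iff_forall_integral_tendsto.mpr hweak
  have hmem : ∀ n y, ξ n y ∈ Set.Icc 0 B := fun n y => ⟨hξ_nonneg n y, hξ_bdd n y⟩
  have hmem₀ : ∀ y, ξ₀ y ∈ Set.Icc 0 B := fun y => ⟨hξ₀_nonneg y, hξ₀_bdd y⟩
  have hφ := Real.continuous_mul_log
  obtain ⟨C, hC⟩ := (isCompact_Icc (a := 0) (b := B)).exists_bound_of_continuousOn hφ.continuousOn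
  exact (ProbabilityMeasure.tendsto_integral_of_tendstoUniformlyOn hQ
    (fun n => hφ.comp (hξ_cont n)) (hφ.comp hξ₀_cont)
    (fun n y => hC _ (hmem n y)) (fun y => hC _ (hmem₀ y))
    (fun K hK => (hunif K hK).comp_continuousOn_isCompact isCompact_Icc hφ.continuousOn
      hmem hmem₀)).const_add _
end
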